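/- arXiv:math/0508373 — 4 statements merged into one kernel-verified Lean document; each statement's English description precedes it below -/
import Mathlib

section
/- Let g = ⊕_{j∈ℤ} g_j be a finite-dimensional ℤ-graded Lie algebra over a field F of depth q which is irreducible and transitive, in which the only Lie ideal contained in g_- is the zero ideal, and which satisfies g_{-i} = ⁅g_{-1}, g_{-i+1}⁆ for every i ≥ 2. If x ∈ g satisfies ⁅x, g_{-1}⁆ = 0, then x ∈ g_{-q}. -/
/-- The sum of the negative homogeneous components of a graded Lie algebra. -/
def negPart {F L : Type*} [Field F] [LieRing L] [LieAlgebra F L]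
    (g : ℤ → Submodule F L) : Submodule F L :=
  ⨆ j < (0 : ℤ), g j

/-- The sum of the nonnegative homogeneous components of a graded Lie algebra. -/
def nonnegPart {F L : Type*} [Field F] [LieRing L] [LieAlgebra F L]
    (g : ℤ → Submodule F L) : Submodule F L :=
  ⨆ j ≥ (0 : ℤ), g j

/-- The linear span of all brackets `⁅x, y⁆` with `x ∈ A`, `y ∈ B`. -/
def bracketSpan {F L : Type*} [Field F] [LieRing L] [LieAlgebra F L]
    (A B : Submodule F L) : Submodule F L :=
  Submodule.span F {z : L | ∃ x ∈ A, ∃ y ∈ B, z = ⁅x, y⁆}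

section GradedLie

variable {F L : Type*} [Field F] [LieRing L] [LieAlgebra F L]

/-- Membership in the smallest subspace containing `V` and stable under bracketing with
the components of positive degree. -/
inductive PosClosure (g : ℤ → Submodule F L) (V : Submodule F L) : L → Prop
  | base (v : L) (hv : v ∈ V) : PosClosure g V v
  | add (a b : L) (ha : PosClosure g V a) (hb : PosClosure g V b) : PosClosure g V (a + b)
  | smul (c : F) (a : L) (ha : PosClosure g V a) : PosClosure g V (c • a)
  | lie (k : ℤ) (hk : 0 < k) (z : L) (hz : z ∈ g k) (a : L) (ha : PosClosure g V a) :
      PosClosure g V ⁅z, a⁆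

/-- The smallest subspace containing `V` and stable under bracketing with the components of
positive degree. -/
def posClosure (g : ℤ → Submodule F L) (V : Submodule F L) : Submodule F L where
  carrier := {a | PosClosure g V a}
  add_mem' ha hb := .add _ _ ha hb
  zero_mem' := .base 0 V.zero_mem
  smul_mem' c _ ha := .smul c _ ha

/-- The elements of `g d` annihilated by `g (-1)`. -/
def homogeneousAnnihilator (g : ℤ → Submodule F L) (d : ℤ) : Submodule F L where
  carrier := {v | v ∈ g d ∧ ∀ y ∈ g (-1), ⁅v, y⁆ = 0}
  add_mem' ha hb := ⟨add_mem ha.1 hb.1, fun y hy => by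
    rw [add_lie, ha.2 y hy, hb.2 y hy, add_zero]⟩
  zero_mem' := ⟨zero_mem _, fun y _ => zero_lie y⟩
  smul_mem' c _ ha := ⟨Submodule.smul_mem _ c ha.1, fun y hy => by
    rw [smul_lie, ha.2 y hy, smul_zero]⟩

/-- If `V` is stable under `g 0` and killed by the components of negative degree, then
`posClosure g V` is a Lie ideal. -/
theorem lie_mem_posClosure (g : ℤ → Submodule F L) (htop : iSup g = ⊤) (V : Submodule F L)
    (hV0 : ∀ z ∈ g 0, ∀ v ∈ V, ⁅z, v⁆ ∈ V)
    (hVneg : ∀ k < 0, ∀ z ∈ g k, ∀ v ∈ V, ⁅z, v⁆ = 0)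
    (y : L) {a : L} (ha : a ∈ posClosure g V) : ⁅y, a⁆ ∈ posClosure g V := by
  change PosClosure g V a at ha
  induction ha generalizing y with
  | base v hv =>
    have hy : y ∈ iSup g := htop ▸ Submodule.mem_top
    induction hy using Submodule.iSup_induction' with
    | mem k z hz =>
      rcases lt_trichotomy k 0 with hk | rfl | hk
      · rw [hVneg k hk z hz v hv]; exact zero_mem _
      · exact PosClosure.base _ (hV0 z hz v hv)
      · exact PosClosure.lie k hk z hz v (.base v hv)
    | zero => rw [zero_lie]; exact zero_mem _
    | add u w _ _ hu hw => rw [add_lie]; exact add_mem hu hw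
  | add a b _ _ iha ihb => rw [lie_add]; exact add_mem (iha y) (ihb y)
  | smul c a _ iha => rw [lie_smul]; exact Submodule.smul_mem _ c (iha y)
  | lie k hk z hz a _ iha =>
    rw [leibniz_lie]
    exact add_mem (iha _) (PosClosure.lie k hk z hz _ (iha y))

/-- An element annihilated by `g (-1)` is annihilated by every component of negative degree. -/
theorem lie_eq_zero_of_neg (g : ℤ → Submodule F L)
    (hgen : ∀ i : ℤ, 2 ≤ i → g (-i) = bracketSpan (g (-1)) (g (-(i - 1))))
    (v : L) (hv : ∀ y ∈ g (-1), ⁅v, y⁆ = 0) (n : ℤ) (hn : 1 ≤ n) :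
    ∀ z ∈ g (-n), ⁅v, z⁆ = 0 := by
  induction n, hn using Int.leInduction with
  | base => exact hv
  | succ n hn ih =>
    intro z hz
    rw [hgen (n + 1) (by lia), bracketSpan] at hz
    induction hz using Submodule.span_induction with
    | mem w hw =>
      obtain ⟨a, ha, b, hb, rfl⟩ := hw
      rw [add_sub_cancel_right] at hb
      rw [leibniz_lie, hv a ha, ih b hb, zero_lie, lie_zero, add_zero]
    | zero => exact lie_zero v
    | add a b _ _ iha ihb => rw [lie_add, iha, ihb, add_zero]
    | smul c a _ iha => rw [lie_smul, iha, smul_zero]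

/-- A Lie ideal containing `g (-1)` contains every component of negative degree. -/
theorem neg_le_of_neg_one_le (g : ℤ → Submodule F L)
    (hgen : ∀ i : ℤ, 2 ≤ i → g (-i) = bracketSpan (g (-1)) (g (-(i - 1))))
    (A : Submodule F L) (hA : ∀ y : L, ∀ a ∈ A, ⁅y, a⁆ ∈ A) (h : g (-1) ≤ A)
    (n : ℤ) (hn : 1 ≤ n) : g (-n) ≤ A := by
  induction n, hn using Int.leInduction with
  | base => exact h
  | succ n hn ih =>
    rw [hgen (n + 1) (by lia), bracketSpan, Submodule.span_le]
    rintro _ ⟨a, _, b, hb, rfl⟩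
    rw [add_sub_cancel_right] at hb
    exact hA a b (ih hb)

variable (g : ℤ → Submodule F L) [DirectSum.Decomposition g]

open DirectSum

theorem decompose_lie_left
    (hgraded : ∀ i j : ℤ, ∀ x ∈ g i, ∀ y ∈ g j, ⁅x, y⁆ ∈ g (i + j))
    {k : ℤ} {z : L} (hz : z ∈ g k) (a : L) (j : ℤ) :
    (decompose g ⁅z, a⁆ j : L) = ⁅z, (decompose g a (j - k) : L)⁆ := by
  induction a using DirectSum.Decomposition.inductionOn g with
  | zero => simp
  | @homogeneous i m =>
    by_cases h : i = j - k
    · subst h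
      have := hgraded k (j - k) z hz m m.2
      rw [add_sub_cancel] at this
      rw [decompose_of_mem_same g this, decompose_of_mem_same g m.2]
    · rw [decompose_of_mem_ne g (hgraded k i z hz m m.2) (by lia),
        decompose_of_mem_ne g m.2 h, lie_zero]
  | add a b iha ihb => simp [lie_add, iha, ihb]

theorem decompose_mem_posClosure
    (hgraded : ∀ i j : ℤ, ∀ x ∈ g i, ∀ y ∈ g j, ⁅x, y⁆ ∈ g (i + j))
    (d : ℤ) (V : Submodule F L) (hV : V ≤ g d) {a : L} (ha : a ∈ posClosure g V) (j : ℤ) :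
    (decompose g a j : L) ∈ posClosure g V ∧ (j < d → (decompose g a j : L) = 0) := by
  change PosClosure g V a at ha
  induction ha generalizing j with
  | base v hv =>
    by_cases h : d = j
    · subst h
      rw [decompose_of_mem_same g (hV hv)]
      exact ⟨.base v hv, fun h => absurd h (lt_irrefl _)⟩
    · rw [decompose_of_mem_ne g (hV hv) h]
      exact ⟨zero_mem _, fun _ => rfl⟩
  | add a b _ _ iha ihb =>
    rw [decompose_add, DirectSum.add_apply, Submodule.coe_add]
    exact ⟨add_mem (iha j).1 (ihb j).1, fun h => by rw [(iha j).2 h, (ihb j).2 h, add_zero]⟩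
  | smul c a _ iha =>
    rw [decompose_smul, DirectSum.smul_apply, Submodule.coe_smul]
    exact ⟨Submodule.smul_mem _ c (iha j).1, fun h => by rw [(iha j).2 h, smul_zero]⟩
  | lie k hk z hz a _ iha =>
    rw [decompose_lie_left g hgraded hz]
    exact ⟨.lie k hk z hz _ (iha _).1, fun h => by rw [(iha (j - k)).2 (by lia), lie_zero]⟩

/-- In a transitive graded Lie algebra, a Lie ideal with a nonzero homogeneous element of
degree at least `-1` has a nonzero element in degree `-1`. -/
theorem exists_neg_one_mem_of_transitive {g : ℤ → Submodule F L}
    (hgraded : ∀ i j : ℤ, ∀ x ∈ g i, ∀ y ∈ g j, ⁅x, y⁆ ∈ g (i + j))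
    (htrans : ∀ x ∈ nonnegPart g, (∀ y ∈ g (-1), ⁅x, y⁆ = 0) → x = 0)
    (A : Submodule F L) (hA : ∀ y : L, ∀ a ∈ A, ⁅y, a⁆ ∈ A) (k : ℤ) (hk : -1 ≤ k) :
    ∀ a ∈ A, a ∈ g k → a ≠ 0 → ∃ b ∈ A, b ∈ g (-1) ∧ b ≠ 0 := by
  induction k, hk using Int.leInduction with
  | base => exact fun a ha hg h => ⟨a, ha, hg, h⟩
  | succ k hk ih =>
    intro a ha hg h
    have hn : a ∈ nonnegPart g :=
      Submodule.mem_iSup_of_mem (k + 1) (Submodule.mem_iSup_of_mem (by lia) hg)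
    have hex : ∃ y ∈ g (-1), ⁅a, y⁆ ≠ 0 := by
      by_contra! hcon
      exact h (htrans a hn hcon)
    obtain ⟨y, hy, hne⟩ := hex
    refine ih ⁅a, y⁆ ?_ ?_ hne
    · rw [← lie_skew]; exact neg_mem (hA y a ha)
    · simpa using hgraded _ _ a hg y hy

end GradedLie

/-- In a finite-dimensional irreducible transitive graded Lie algebra of depth `q`
with vanishing Weisfeiler radical and negative part generated by `g (-1)`,
any element annihilated by `g (-1)` lies in `g (-q)`. -/
theorem statement6 {F L : Type*} [Field F] [LieRing L] [LieAlgebra F L]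
    [FiniteDimensional F L]
    (g : ℤ → Submodule F L)
    (hdirect : DirectSum.IsInternal g)
    (hgraded : ∀ i j : ℤ, ∀ x ∈ g i, ∀ y ∈ g j, ⁅x, y⁆ ∈ g (i + j))
    -- depth q
    (q : ℤ)
    (hdepth_ne : g (-q) ≠ ⊥)
    (hdepth : ∀ j : ℤ, q < j → g (-j) = ⊥)
    -- irreducibility
    (hirr_ne : g (-1) ≠ ⊥)
    (hirr : ∀ W : Submodule F L, W ≤ g (-1) →
      (∀ x ∈ g 0, ∀ w ∈ W, ⁅x, w⁆ ∈ W) → W = ⊥ ∨ W = g (-1))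
    -- transitivity
    (htrans : ∀ x ∈ nonnegPart g, (∀ y ∈ g (-1), ⁅x, y⁆ = 0) → x = 0)
    -- the only Lie ideal contained in the negative part is zero
    (hrad : ∀ J : Submodule F L, (∀ x : L, ∀ y ∈ J, ⁅x, y⁆ ∈ J) →
      J ≤ negPart g → J = ⊥)
    -- g₋ᵢ = ⁅g₋₁, g₋₍ᵢ₋₁₎⁆ for all i ≥ 2
    (hgen : ∀ i : ℤ, 2 ≤ i → g (-i) = bracketSpan (g (-1)) (g (-(i - 1))))
    (x : L)
    (hx : ∀ y ∈ g (-1), ⁅x, y⁆ = 0) :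
    x ∈ g (-q) := by
  classical
  let : DirectSum.Decomposition g := hdirect.chooseDecomposition
  have hq : 1 ≤ q := by
    by_contra! h
    exact hirr_ne (hdepth 1 h)
  have hcomp : ∀ j, ∀ y ∈ g (-1), ⁅(DirectSum.decompose g x j : L), y⁆ = 0 := by
    intro j y hy
    have h := decompose_lie_left g hgraded hy x (j + -1)
    rw [← lie_skew, hx y hy, add_sub_cancel_right] at h
    rw [← lie_skew, ← h]
    simp
  have hzero : ∀ j, j ≠ -q → (DirectSum.decompose g x j : L) = 0 := by
    intro j hj
    have hmem : (DirectSum.decompose g x j : L) ∈ g j := SetLike.coe_mem _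
    rcases lt_or_ge j (-q) with hlt | hge
    · have h := hdepth (-j) (by lia)
      rw [neg_neg] at h
      exact (Submodule.eq_bot_iff _).1 h _ hmem
    rcases le_or_gt 0 j with hpos | hneg
    · exact htrans _ (Submodule.mem_iSup_of_mem j (Submodule.mem_iSup_of_mem hpos hmem)) (hcomp j)
    set V := homogeneousAnnihilator g j
    set A := posClosure g V
    have hA : ∀ y : L, ∀ a ∈ A, ⁅y, a⁆ ∈ A := by
      refine fun y a ha => lie_mem_posClosure g hdirect.submodule_iSup_eq_top V ?_ ?_ y ha
      · refine fun z hz v hv => ⟨by simpa using hgraded 0 j z hz v hv.1, fun y hy => ?_⟩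
        rw [lie_lie, hv.2 y hy, lie_zero, hv.2 _ (by simpa using hgraded 0 (-1) z hz y hy),
          sub_zero]
      · intro k hk z hz v hv
        rw [← lie_skew, lie_eq_zero_of_neg g hgen v hv.2 (-k) (by lia) z (by rwa [neg_neg]),
          neg_zero]
    have hdec : ∀ a ∈ A, ∀ i, _ := fun a ha i =>
      decompose_mem_posClosure g hgraded j V (fun v hv => hv.1) ha i
    have hAneg : A ≤ negPart g := by
      by_contra hnot
      have hex : ∃ a ∈ A, ∃ k : ℤ, 0 ≤ k ∧ (DirectSum.decompose g a k : L) ≠ 0 := by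
        by_contra! hcon
        refine hnot fun a ha => ?_
        rw [← DirectSum.sum_support_decompose g a]
        refine sum_mem fun k _ => ?_
        rcases le_or_gt 0 k with hk | hk
        · rw [hcon a ha k hk]; exact zero_mem _
        · exact Submodule.mem_iSup_of_mem k (Submodule.mem_iSup_of_mem hk (SetLike.coe_mem _))
      obtain ⟨a, ha, k, hk, hne⟩ := hex
      obtain ⟨b, hbA, hb, hb0⟩ := exists_neg_one_mem_of_transitive hgraded htrans A hA k
        (by lia) _ (hdec a ha k).1 (SetLike.coe_mem _) hne
      have hle : g (-1) ≤ A := by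
        rcases hirr (A ⊓ g (-1)) inf_le_right (fun z hz w hw =>
          ⟨hA z w hw.1, by simpa using hgraded 0 (-1) z hz w hw.2⟩) with h | h
        · have : b ∈ A ⊓ g (-1) := ⟨hbA, hb⟩
          rw [h, Submodule.mem_bot] at this
          exact absurd this hb0
        · exact inf_eq_right.mp h
      refine hdepth_ne ((Submodule.eq_bot_iff _).2 fun w hw => ?_)
      have h := (hdec w (neg_le_of_neg_one_le g hgen A hA hle q hq hw) (-q)).2 (by lia)
      rwa [DirectSum.decompose_of_mem_same g hw] at h
    have hxA : (DirectSum.decompose g x j : L) ∈ A := PosClosure.base _ ⟨hmem, hcomp j⟩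
    rwa [hrad A hA hAneg, Submodule.mem_bot] at hxA
  rw [← DirectSum.sum_support_decompose g x]
  refine sum_mem fun j _ => ?_
  by_cases hj : j = -q
  · rw [hj]; exact SetLike.coe_mem _
  · rw [hzero j hj]; exact zero_mem _
end

section
/- Let g = ⊕_{j∈ℤ} g_j be a finite-dimensional ℤ-graded Lie algebra over a field F of depth q which is irreducible and transitive, in which the only Lie ideal contained in g_- is the zero ideal, and which satisfies g_{-i} = ⁅g_{-1}, g_{-i+1}⁆ for every i ≥ 2. Then g_{-q} is an irreducible g_0-module: the only subspaces W of g_{-q} with ⁅g_0, W⁆ ⊆ W are 0 and g_{-q}. -/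
/-- The elements obtained from a subspace `W`, placed in degree `d`, by repeatedly bracketing with
homogeneous elements of positive degree, together with the degree in which they arise. -/
inductive PositiveBracket {F L : Type*} [Field F] [LieRing L] [LieAlgebra F L]
    (g : ℤ → Submodule F L) (W : Submodule F L) (d : ℤ) : ℤ → L → Prop
  | base (w : L) (hw : w ∈ W) : PositiveBracket g W d d w
  | step (i e : ℤ) (hi : 0 < i) (y x : L) (hy : y ∈ g i) (hx : PositiveBracket g W d e x) :
      PositiveBracket g W d (i + e) ⁅y, x⁆

/-- The span of all iterated brackets of elements of `W` with homogeneous elements of positive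
degree. -/
def positiveClosure {F L : Type*} [Field F] [LieRing L] [LieAlgebra F L]
    (g : ℤ → Submodule F L) (W : Submodule F L) (d : ℤ) : Submodule F L :=
  Submodule.span F {x | ∃ e, PositiveBracket g W d e x}

section

variable {F L : Type*} [Field F] [LieRing L] [LieAlgebra F L]
  {g : ℤ → Submodule F L} {W : Submodule F L} {d : ℤ}

theorem PositiveBracket.mem
    (hgraded : ∀ i j : ℤ, ∀ x ∈ g i, ∀ y ∈ g j, ⁅x, y⁆ ∈ g (i + j)) (hW : W ≤ g d)
    {e : ℤ} {x : L} (hx : PositiveBracket g W d e x) : x ∈ g e := by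
  induction hx with
  | base w hw => exact hW hw
  | step i e hi y x hy _ ih => exact hgraded i e y hy x ih

theorem PositiveBracket.mem_or_lt {e : ℤ} {x : L} (hx : PositiveBracket g W d e x) :
    x ∈ W ∨ d < e := by
  have hle : ∀ {e : ℤ} {x : L}, PositiveBracket g W d e x → d ≤ e := by
    intro e x hx
    induction hx with
    | base => exact le_rfl
    | step => omega
  cases hx with
  | base _ hw => exact Or.inl hw
  | step i e hi y x hy hx =>
    have := hle hx
    exact Or.inr (by omega)

theorem le_positiveClosure : W ≤ positiveClosure g W d :=
  fun w hw => Submodule.subset_span ⟨d, .base w hw⟩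

theorem lie_mem_positiveClosure_of_pos {i : ℤ} (hi : 0 < i) {y x : L} (hy : y ∈ g i)
    (hx : x ∈ positiveClosure g W d) : ⁅y, x⁆ ∈ positiveClosure g W d := by
  induction hx using Submodule.span_induction with
  | mem x hx =>
    obtain ⟨e, hx⟩ := hx
    exact Submodule.subset_span ⟨i + e, .step i e hi y x hy hx⟩
  | zero => simp
  | add a b _ _ ha hb => rw [lie_add]; exact add_mem ha hb
  | smul c a _ ha => rw [lie_smul]; exact Submodule.smul_mem _ c ha

/-- If `W` is a `g 0`-submodule of the component of lowest degree, its closure under brackets with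
elements of positive degree is a Lie ideal. -/
theorem lie_mem_positiveClosure (htop : ⨆ i, g i = ⊤)
    (hgraded : ∀ i j : ℤ, ∀ x ∈ g i, ∀ y ∈ g j, ⁅x, y⁆ ∈ g (i + j)) (hW : W ≤ g d)
    (hbot : ∀ j < d, g j = ⊥) (hW0 : ∀ x ∈ g 0, ∀ w ∈ W, ⁅x, w⁆ ∈ W)
    (y : L) {x : L} (hx : x ∈ positiveClosure g W d) : ⁅y, x⁆ ∈ positiveClosure g W d := by
  have key : ∀ (e : ℤ) (x : L), PositiveBracket g W d e x → ∀ j : ℤ, ∀ y ∈ g j,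
      ⁅y, x⁆ ∈ positiveClosure g W d := by
    intro e x hx
    induction hx with
    | base w hw =>
      intro j y hy
      rcases lt_trichotomy j 0 with hj | rfl | hj
      · have h := hgraded j d y hy w (hW hw)
        rw [hbot (j + d) (by omega), Submodule.mem_bot] at h
        rw [h]
        exact zero_mem _
      · exact le_positiveClosure (hW0 y hy w hw)
      · exact lie_mem_positiveClosure_of_pos hj hy (le_positiveClosure hw)
    | step i e hi z x hz _ ih =>
      intro j y hy
      rw [leibniz_lie]
      exact add_mem (ih (j + i) _ (hgraded j i y hy z hz))
        (lie_mem_positiveClosure_of_pos hi hz (ih j y hy))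
  induction hx using Submodule.span_induction with
  | mem x hx =>
    obtain ⟨e, hx⟩ := hx
    have hy : y ∈ ⨆ i, g i := htop ▸ Submodule.mem_top
    induction hy using Submodule.iSup_induction' with
    | mem j y hy => exact key e x hx j y hy
    | zero => simp
    | add a b _ _ ha hb => rw [add_lie]; exact add_mem ha hb
  | zero => simp
  | add a b _ _ ha hb => rw [lie_add]; exact add_mem ha hb
  | smul c a _ ha => rw [lie_smul]; exact Submodule.smul_mem _ c ha

theorem positiveClosure_inf_le (hindep : iSupIndep g)
    (hgraded : ∀ i j : ℤ, ∀ x ∈ g i, ∀ y ∈ g j, ⁅x, y⁆ ∈ g (i + j)) (hW : W ≤ g d) :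
    positiveClosure g W d ⊓ g d ≤ W := by
  rintro x ⟨hxJ, hxd⟩
  have hle : positiveClosure g W d ≤ W ⊔ ⨆ j ≠ d, g j := by
    refine Submodule.span_le.2 ?_
    rintro z ⟨e, hz⟩
    rcases hz.mem_or_lt with h | h
    · exact Submodule.mem_sup_left h
    · exact Submodule.mem_sup_right
        (Submodule.mem_iSup_of_mem e (Submodule.mem_iSup_of_mem h.ne' (hz.mem hgraded hW)))
  obtain ⟨w, hw, r, hr, rfl⟩ := Submodule.mem_sup.1 (hle hxJ)
  have hrd : r ∈ g d := by simpa using sub_mem hxd (hW hw)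
  have hr0 : r = 0 := Submodule.disjoint_def.1 (hindep d) r hrd hr
  simpa [hr0] using hw

/-- In a transitive graded Lie algebra, an ideal meeting a component of nonnegative degree
nontrivially meets `g (-1)` nontrivially. -/
theorem exists_ne_zero_mem_inf_neg_one
    (hgraded : ∀ i j : ℤ, ∀ x ∈ g i, ∀ y ∈ g j, ⁅x, y⁆ ∈ g (i + j))
    (htrans : ∀ x ∈ nonnegPart g, (∀ y ∈ g (-1), ⁅x, y⁆ = 0) → x = 0)
    {J : Submodule F L} (hJ : ∀ x : L, ∀ y ∈ J, ⁅x, y⁆ ∈ J) (n : ℕ) :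
    ∀ x ∈ J, x ∈ g n → x ≠ 0 → ∃ z ∈ J, z ∈ g (-1) ∧ z ≠ 0 := by
  induction n with
  | zero =>
    intro x hxJ hx hx0
    by_contra! h
    refine hx0 (htrans x (Submodule.mem_iSup_of_mem 0 (Submodule.mem_iSup_of_mem le_rfl hx)) ?_)
    intro y hy
    refine h _ ?_ (by simpa using hgraded _ _ x hx y hy)
    rw [← lie_skew]
    exact neg_mem (hJ y x hxJ)
  | succ n ih =>
    intro x hxJ hx hx0
    by_contra! h
    refine hx0 (htrans x (Submodule.mem_iSup_of_mem ((n + 1 : ℕ) : ℤ)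
      (Submodule.mem_iSup_of_mem (Int.natCast_nonneg _) hx)) ?_)
    intro y hy
    by_contra hne
    obtain ⟨z, hzJ, hz, hz0⟩ := ih ⁅x, y⁆
      (by rw [← lie_skew]; exact neg_mem (hJ y x hxJ))
      (by simpa using hgraded _ _ x hx y hy) hne
    exact hz0 (h z hzJ hz)

/-- If the negative part is generated by `g (-1)`, an ideal containing `g (-1)` contains every
component of negative degree. -/
theorem neg_component_le
    (hgen : ∀ i : ℤ, 2 ≤ i → g (-i) = bracketSpan (g (-1)) (g (-(i - 1))))
    {J : Submodule F L} (hJ : ∀ x : L, ∀ y ∈ J, ⁅x, y⁆ ∈ J) (h1 : g (-1) ≤ J)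
    {i : ℤ} (hi : 1 ≤ i) : g (-i) ≤ J := by
  induction i, hi using Int.leInduction with
  | base => exact h1
  | succ i hi ih =>
    rw [hgen (i + 1) (by omega), add_sub_cancel_right]
    refine Submodule.span_le.2 ?_
    rintro z ⟨x, -, y, hy, rfl⟩
    exact hJ x y (ih hy)

end

/-- In a finite-dimensional irreducible transitive graded Lie algebra of depth `q`
with vanishing Weisfeiler radical and negative part generated by `g (-1)`,
the component `g (-q)` is an irreducible `g 0`-module. -/
theorem statement7 {F L : Type*} [Field F] [LieRing L] [LieAlgebra F L]
    [FiniteDimensional F L]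
    (g : ℤ → Submodule F L)
    (hdirect : DirectSum.IsInternal g)
    (hgraded : ∀ i j : ℤ, ∀ x ∈ g i, ∀ y ∈ g j, ⁅x, y⁆ ∈ g (i + j))
    -- depth q
    (q : ℤ)
    (hdepth_ne : g (-q) ≠ ⊥)
    (hdepth : ∀ j : ℤ, q < j → g (-j) = ⊥)
    -- irreducibility
    (hirr_ne : g (-1) ≠ ⊥)
    (hirr : ∀ W : Submodule F L, W ≤ g (-1) →
      (∀ x ∈ g 0, ∀ w ∈ W, ⁅x, w⁆ ∈ W) → W = ⊥ ∨ W = g (-1))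
    -- transitivity
    (htrans : ∀ x ∈ nonnegPart g, (∀ y ∈ g (-1), ⁅x, y⁆ = 0) → x = 0)
    -- the only Lie ideal contained in the negative part is zero
    (hrad : ∀ J : Submodule F L, (∀ x : L, ∀ y ∈ J, ⁅x, y⁆ ∈ J) →
      J ≤ negPart g → J = ⊥)
    -- g₋ᵢ = ⁅g₋₁, g₋₍ᵢ₋₁₎⁆ for all i ≥ 2
    (hgen : ∀ i : ℤ, 2 ≤ i → g (-i) = bracketSpan (g (-1)) (g (-(i - 1)))) :
    ∀ W : Submodule F L, W ≤ g (-q) →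
      (∀ x ∈ g 0, ∀ w ∈ W, ⁅x, w⁆ ∈ W) → W = ⊥ ∨ W = g (-q) := by
  intro W hW hW0
  refine or_iff_not_imp_left.2 fun hWne => le_antisymm hW ?_
  have hbot : ∀ j < -q, g j = ⊥ := fun j hj => by simpa using hdepth (-j) (by omega)
  have hq : 1 ≤ q := by
    by_contra h
    exact hirr_ne (hdepth 1 (by omega))
  set J := positiveClosure g W (-q)
  have hJ : ∀ x : L, ∀ y ∈ J, ⁅x, y⁆ ∈ J := fun x y hy =>
    lie_mem_positiveClosure hdirect.submodule_iSup_eq_top hgraded hW hbot hW0 x hy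
  have hJneg : ¬ J ≤ negPart g := fun h =>
    hWne (le_bot_iff.1 (hrad J hJ h ▸ le_positiveClosure))
  obtain ⟨x, ⟨e, hx⟩, hxneg⟩ : ∃ x ∈ {x | ∃ e, PositiveBracket g W (-q) e x}, x ∉ negPart g := by
    by_contra! h
    exact hJneg (Submodule.span_le.2 h)
  have hxe := hx.mem hgraded hW
  have he : 0 ≤ e := by
    by_contra! h
    exact hxneg (Submodule.mem_iSup_of_mem e (Submodule.mem_iSup_of_mem h hxe))
  have hx0 : x ≠ 0 := fun h => hxneg (h ▸ zero_mem _)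
  lift e to ℕ using he
  obtain ⟨z, hzJ, hz, hz0⟩ := exists_ne_zero_mem_inf_neg_one hgraded htrans hJ e x
    (Submodule.subset_span ⟨e, hx⟩) hxe hx0
  have h1 : g (-1) ≤ J := by
    rcases hirr (J ⊓ g (-1)) inf_le_right fun x hx w hw =>
        ⟨hJ x w hw.1, by simpa using hgraded _ _ x hx w hw.2⟩ with h | h
    · exact absurd ((Submodule.mem_bot F).1 (h ▸ (⟨hzJ, hz⟩ : z ∈ J ⊓ g (-1)))) hz0
    · exact inf_eq_right.1 h
  exact (le_inf (neg_component_le hgen hJ h1 hq) le_rfl).trans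
    (positiveClosure_inf_le hdirect.submodule_iSupIndep hgraded hW)
end

section
/- Let g = ⊕_{j∈ℤ} g_j be a ℤ-graded Lie algebra of depth q and height r satisfying conditions (1.6), and suppose 2 ≤ q ≤ r. Then g_{-q+i} = ⁅g_{-q}, g_i⁆ for every integer i with 0 ≤ i ≤ q−1. -/
section Graded

variable {F L : Type*} [Field F] [LieRing L] [LieAlgebra F L]

theorem bracketSpan_le {A B C : Submodule F L} (h : ∀ x ∈ A, ∀ y ∈ B, ⁅x, y⁆ ∈ C) :
    bracketSpan A B ≤ C := by
  refine Submodule.span_le.2 ?_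
  rintro _ ⟨x, hx, y, hy, rfl⟩
  exact h x hx y hy

theorem lie_mem_bracketSpan {A B : Submodule F L} {x y : L} (hx : x ∈ A) (hy : y ∈ B) :
    ⁅x, y⁆ ∈ bracketSpan A B :=
  Submodule.subset_span ⟨x, hx, y, hy, rfl⟩

/-- If `⁅x, ·⁆` maps the brackets of `A` and `B` into `C`, it maps their span into `C`. -/
theorem lie_mem_of_mem_bracketSpan {A B C : Submodule F L} {x w : L}
    (hw : w ∈ bracketSpan A B) (h : ∀ a ∈ A, ∀ b ∈ B, ⁅x, ⁅a, b⁆⁆ ∈ C) : ⁅x, w⁆ ∈ C :=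
  bracketSpan_le (C := C.comap (LieAlgebra.ad F L x : L →ₗ[F] L)) h hw

/-- The homogeneous elements, with their degree, obtained from `g d` by repeated brackets with
elements of nonnegative degree. -/
inductive NonnegOrbit (g : ℤ → Submodule F L) (d : ℤ) : ℤ → L → Prop
  | base (x : L) (hx : x ∈ g d) : NonnegOrbit g d d x
  | step (k j : ℤ) (a x : L) (hj : 0 ≤ j) (ha : a ∈ g j) (hx : NonnegOrbit g d k x) :
      NonnegOrbit g d (j + k) ⁅a, x⁆

/-- The submodule generated by `g d` under brackets with elements of nonnegative degree. -/
def nonnegOrbitSpan (g : ℤ → Submodule F L) (d : ℤ) : Submodule F L :=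
  Submodule.span F {x : L | ∃ k, NonnegOrbit g d k x}

variable {g : ℤ → Submodule F L} {d : ℤ}

theorem NonnegOrbit.mem_span {k : ℤ} {x : L} (h : NonnegOrbit g d k x) :
    x ∈ nonnegOrbitSpan g d :=
  Submodule.subset_span ⟨k, h⟩

theorem NonnegOrbit.mem_homogeneous
    (hgraded : ∀ i j : ℤ, ∀ x ∈ g i, ∀ y ∈ g j, ⁅x, y⁆ ∈ g (i + j))
    {k : ℤ} {x : L} (h : NonnegOrbit g d k x) : x ∈ g k := by
  induction h with
  | base x hx => exact hx
  | step k j a x hj ha _ ih => exact hgraded j k a ha x ih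

theorem lie_mem_nonnegOrbitSpan_of_generators {a x : L}
    (h : ∀ k y, NonnegOrbit g d k y → ⁅a, y⁆ ∈ nonnegOrbitSpan g d)
    (hx : x ∈ nonnegOrbitSpan g d) : ⁅a, x⁆ ∈ nonnegOrbitSpan g d := by
  have : nonnegOrbitSpan g d ≤
      (nonnegOrbitSpan g d).comap (LieAlgebra.ad F L a : L →ₗ[F] L) :=
    Submodule.span_le.2 fun y ⟨k, hy⟩ ↦ h k y hy
  exact this hx

theorem lie_mem_nonnegOrbitSpan_of_nonneg {j : ℤ} (hj : 0 ≤ j) {a x : L} (ha : a ∈ g j)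
    (hx : x ∈ nonnegOrbitSpan g d) : ⁅a, x⁆ ∈ nonnegOrbitSpan g d :=
  lie_mem_nonnegOrbitSpan_of_generators (fun k y hy ↦ (hy.step k j a y hj ha).mem_span) hx

/-- If `g (-1)` annihilates `g d`, then the nonnegative orbit of `g d` is stable under `g (-1)`. -/
theorem lie_mem_nonnegOrbitSpan_of_neg_one
    (hgraded : ∀ i j : ℤ, ∀ x ∈ g i, ∀ y ∈ g j, ⁅x, y⁆ ∈ g (i + j))
    (hd : ∀ a ∈ g (-1), ∀ x ∈ g d, ⁅a, x⁆ = 0)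
    {a x : L} (ha : a ∈ g (-1)) (hx : x ∈ nonnegOrbitSpan g d) :
    ⁅a, x⁆ ∈ nonnegOrbitSpan g d := by
  refine lie_mem_nonnegOrbitSpan_of_generators (fun k y hy ↦ ?_) hx
  clear hx x
  induction hy generalizing a with
  | base x hx => rw [hd a ha x hx]; exact zero_mem _
  | step k j b x hj hb hx ih =>
    rw [leibniz_lie]
    refine add_mem ?_ (lie_mem_nonnegOrbitSpan_of_nonneg hj hb (ih ha))
    have hab := hgraded _ _ a ha b hb
    rcases hj.eq_or_lt with rfl | hj
    · exact ih (by simpa using hab)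
    · exact lie_mem_nonnegOrbitSpan_of_nonneg (by omega) hab hx.mem_span

/-- A submodule stable under every `g j` with `j ≥ -1` is an ideal, if `g (-1)` generates the
negative part. -/
theorem lie_mem_of_stable (htop : iSup g = ⊤)
    (hgen : ∀ i : ℤ, 2 ≤ i → g (-i) = bracketSpan (g (-1)) (g (-(i - 1))))
    {M : Submodule F L} (hM : ∀ j : ℤ, -1 ≤ j → ∀ a ∈ g j, ∀ x ∈ M, ⁅a, x⁆ ∈ M)
    (a x : L) (hx : x ∈ M) : ⁅a, x⁆ ∈ M := by
  let S : Submodule F L :=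
    { carrier := {a | ∀ x ∈ M, ⁅a, x⁆ ∈ M}
      add_mem' := fun ha hb x hx ↦ by rw [add_lie]; exact add_mem (ha x hx) (hb x hx)
      zero_mem' := fun x _ ↦ by simp
      smul_mem' := fun c a ha x hx ↦ by rw [smul_lie]; exact M.smul_mem c (ha x hx) }
  have hneg : ∀ n : ℕ, g (-(n + 1 : ℤ)) ≤ S := by
    intro n
    induction n with
    | zero => exact fun a ha x hx ↦ hM (-1) le_rfl a (by simpa using ha) x hx
    | succ n ih =>
      rw [hgen _ (by push_cast; omega)]
      refine bracketSpan_le fun a ha b hb x hx ↦ ?_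
      rw [lie_lie]
      have hb' : b ∈ S := ih (by convert hb using 2; push_cast; ring)
      exact sub_mem (hM _ le_rfl a ha _ (hb' x hx)) (hb' _ (hM _ le_rfl a ha x hx))
  have hS : iSup g ≤ S := by
    refine iSup_le fun j ↦ ?_
    rcases lt_or_ge j (-1) with hj | hj
    · obtain ⟨n, rfl⟩ : ∃ n : ℕ, j = -(n + 1 : ℤ) := ⟨(-j - 1).toNat, by omega⟩
      exact hneg n
    · exact fun a ha x hx ↦ hM j hj a ha x hx
  exact hS (htop ▸ Submodule.mem_top) x hx

theorem mem_nonnegPart {j : ℤ} (hj : 0 ≤ j) {x : L} (hx : x ∈ g j) : x ∈ nonnegPart g :=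
  Submodule.mem_iSup_of_mem j (Submodule.mem_iSup_of_mem hj hx)

/-- In a transitive graded Lie algebra, if the bottom component `g (-q)` annihilates `g (q - 1)`,
then it annihilates every higher component. -/
theorem lie_eq_zero_of_bottom
    (hgraded : ∀ i j : ℤ, ∀ x ∈ g i, ∀ y ∈ g j, ⁅x, y⁆ ∈ g (i + j))
    (htrans : ∀ x ∈ nonnegPart g, (∀ y ∈ g (-1), ⁅x, y⁆ = 0) → x = 0) {q : ℤ}
    (hbot : ∀ a ∈ g (-1), ∀ z ∈ g (-q), ⁅a, z⁆ = 0)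
    (h0 : ∀ z ∈ g (-q), ∀ y ∈ g (q - 1), ⁅z, y⁆ = 0)
    {i : ℤ} (hi : q - 1 ≤ i) : ∀ z ∈ g (-q), ∀ y ∈ g i, ⁅z, y⁆ = 0 := by
  induction i, hi using Int.leInduction with
  | base => exact h0
  | succ i hi ih =>
    intro z hz y hy
    refine htrans _ (mem_nonnegPart (by omega) (hgraded _ _ z hz y hy)) fun a ha ↦ ?_
    have hya : ⁅y, a⁆ ∈ g i := by simpa using hgraded _ _ y hy a ha
    have hza : ⁅z, a⁆ = 0 := by rw [← lie_skew, hbot a ha z hz, neg_zero]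
    rw [lie_lie, ih z hz _ hya, hza, lie_zero, sub_zero]

/-- In a transitive graded Lie algebra, a submodule stable under `g (-1)` and containing a nonzero
homogeneous element of degree at least `-1` meets `g (-1)` nontrivially. -/
theorem inf_neg_one_ne_bot
    (hgraded : ∀ i j : ℤ, ∀ x ∈ g i, ∀ y ∈ g j, ⁅x, y⁆ ∈ g (i + j))
    (htrans : ∀ x ∈ nonnegPart g, (∀ y ∈ g (-1), ⁅x, y⁆ = 0) → x = 0)
    {M : Submodule F L} (hM : ∀ a ∈ g (-1), ∀ x ∈ M, ⁅a, x⁆ ∈ M)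
    {k : ℤ} (hk : -1 ≤ k) {x : L} (hxM : x ∈ M) (hx : x ∈ g k) (hx0 : x ≠ 0) :
    M ⊓ g (-1) ≠ ⊥ := by
  induction k, hk using Int.leInduction generalizing x with
  | base => exact fun h ↦ hx0 ((Submodule.mem_bot F).1 (h ▸ ⟨hxM, hx⟩))
  | succ k hk ih =>
    obtain ⟨a, ha, hne⟩ : ∃ a ∈ g (-1), ⁅x, a⁆ ≠ 0 := by
      by_contra! h
      exact hx0 (htrans x (mem_nonnegPart (by omega) hx) h)
    refine ih (x := ⁅x, a⁆) ?_ (by simpa using hgraded _ _ x hx a ha) hne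
    rw [← lie_skew]
    exact neg_mem (hM a ha x hxM)

end Graded

/-- In a graded Lie algebra of depth `q` and height `r` satisfying conditions (1.6),
with `2 ≤ q ≤ r`, one has `g (-q+i) = ⁅g (-q), g i⁆` for `0 ≤ i ≤ q - 1`. -/
theorem statement11 {F L : Type*} [Field F] [LieRing L] [LieAlgebra F L]
    [FiniteDimensional F L]
    (hchar2 : ringChar F ≠ 2) (hchar3 : ringChar F ≠ 3)
    (g : ℤ → Submodule F L)
    (hdirect : DirectSum.IsInternal g)
    (hgraded : ∀ i j : ℤ, ∀ x ∈ g i, ∀ y ∈ g j, ⁅x, y⁆ ∈ g (i + j))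
    -- depth q and height r
    (q r : ℤ) (hq : 2 ≤ q) (hqr : q ≤ r)
    (hdepth_ne : g (-q) ≠ ⊥)
    (hdepth : ∀ j : ℤ, q < j → g (-j) = ⊥)
    (hheight_ne : g r ≠ ⊥)
    (hheight : ∀ j : ℤ, r < j → g j = ⊥)
    -- irreducibility
    (hirr_ne : g (-1) ≠ ⊥)
    (hirr : ∀ W : Submodule F L, W ≤ g (-1) →
      (∀ x ∈ g 0, ∀ w ∈ W, ⁅x, w⁆ ∈ W) → W = ⊥ ∨ W = g (-1))
    -- transitivity
    (htrans : ∀ x ∈ nonnegPart g, (∀ y ∈ g (-1), ⁅x, y⁆ = 0) → x = 0)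
    -- the only Lie ideal contained in the negative part is zero
    (hrad : ∀ J : Submodule F L, (∀ x : L, ∀ y ∈ J, ⁅x, y⁆ ∈ J) →
      J ≤ negPart g → J = ⊥)
    -- g₋ᵢ = ⁅g₋₁, g₋₍ᵢ₋₁₎⁆ for all i ≥ 2
    (hgen : ∀ i : ℤ, 2 ≤ i → g (-i) = bracketSpan (g (-1)) (g (-(i - 1)))) :
    ∀ i : ℤ, 0 ≤ i → i ≤ q - 1 → g (-q + i) = bracketSpan (g (-q)) (g i) := by
  have htop : iSup g = ⊤ := hdirect.submodule_iSup_eq_top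
  have hbot : ∀ a ∈ g (-1), ∀ z ∈ g (-q), ⁅a, z⁆ = 0 := fun a ha z hz ↦ by
    have h := hgraded _ _ a ha z hz
    rw [show -1 + -q = -(q + 1) by ring, hdepth _ (by omega)] at h
    exact (Submodule.mem_bot F).1 h
  have hle : ∀ i : ℤ, bracketSpan (g (-q)) (g i) ≤ g (-q + i) :=
    fun i ↦ bracketSpan_le fun x hx y hy ↦ hgraded _ _ x hx y hy
  have hW : bracketSpan (g (-q)) (g (q - 1)) = g (-1) := by
    refine (hirr _ (by convert hle (q - 1) using 2; ring) ?_).resolve_left ?_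
    · refine fun x hx w hw ↦ lie_mem_of_mem_bracketSpan hw fun z hz y hy ↦ ?_
      rw [leibniz_lie]
      exact add_mem
        (lie_mem_bracketSpan (by simpa using hgraded _ _ x hx z hz) hy)
        (lie_mem_bracketSpan hz (by simpa using hgraded _ _ x hx y hy))
    · intro hzero
      have h0 : ∀ z ∈ g (-q), ∀ y ∈ g (q - 1), ⁅z, y⁆ = 0 := fun z hz y hy ↦
        (Submodule.mem_bot F).1 (hzero ▸ lie_mem_bracketSpan hz hy)
      -- The ideal generated by the bottom component is annihilated by `g i` for `i ≥ q - 1`.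
      set M := nonnegOrbitSpan g (-q)
      have hM1 : ∀ a ∈ g (-1), ∀ x ∈ M, ⁅a, x⁆ ∈ M := fun a ha x hx ↦
        lie_mem_nonnegOrbitSpan_of_neg_one hgraded hbot ha hx
      have hM : ∀ a x : L, x ∈ M → ⁅a, x⁆ ∈ M := by
        refine lie_mem_of_stable htop hgen fun j hj a ha x hx ↦ ?_
        rcases hj.eq_or_lt with rfl | hj
        · exact hM1 a ha x hx
        · exact lie_mem_nonnegOrbitSpan_of_nonneg (by omega) ha hx
      have hMne : M ≠ ⊥ := fun h ↦ hdepth_ne <| (Submodule.eq_bot_iff _).2 fun z hz ↦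
        (Submodule.mem_bot F).1 (h ▸ (NonnegOrbit.base z hz).mem_span)
      have hann : ∀ k x, NonnegOrbit g (-q) k x →
          ∀ i : ℤ, q - 1 ≤ i → ∀ y ∈ g i, ⁅y, x⁆ = 0 := by
        intro k x hx
        induction hx with
        | base x hx =>
          intro i hi y hy
          rw [← lie_skew, lie_eq_zero_of_bottom hgraded htrans hbot h0 hi x hx y hy, neg_zero]
        | step k j a x hj ha _ ih =>
          intro i hi y hy
          rw [leibniz_lie, ih i hi y hy, lie_zero, add_zero]
          exact ih _ (by omega) _ (hgraded _ _ y hy a ha)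
      obtain ⟨k, x, hk, hx, hx0⟩ : ∃ k x, 0 ≤ k ∧ NonnegOrbit g (-q) k x ∧ x ≠ 0 := by
        by_contra! h
        refine hMne (hrad M hM (Submodule.span_le.2 ?_))
        rintro x ⟨k, hx⟩
        rcases lt_or_ge k 0 with hk | hk
        · exact Submodule.mem_iSup_of_mem k
            (Submodule.mem_iSup_of_mem hk (hx.mem_homogeneous hgraded))
        · rw [h k x hk hx]; exact zero_mem _
      have hinf := inf_neg_one_ne_bot hgraded htrans hM1 (by omega) hx.mem_span
        (hx.mem_homogeneous hgraded) hx0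
      have hg1 : g (-1) ≤ M := inf_eq_right.1 <|
        (hirr _ inf_le_right fun a ha w hw ↦
          ⟨hM a w hw.1, by simpa using hgraded _ _ a ha w hw.2⟩).resolve_left hinf
      refine hheight_ne ((Submodule.eq_bot_iff _).2 fun y hy ↦
        htrans y (mem_nonnegPart (by omega) hy) fun w hw ↦ ?_)
      have hker : M ≤ LinearMap.ker (LieAlgebra.ad F L y : L →ₗ[F] L) :=
        Submodule.span_le.2 fun v ⟨k, hv⟩ ↦ hann k v hv r (by omega) y hy
      exact hker (hg1 hw)
  have key : ∀ n : ℕ, g (-q + (q - 1 - n)) ≤ bracketSpan (g (-q)) (g (q - 1 - n)) := by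
    intro n
    induction n with
    | zero => simp [hW, show -q + (q - 1) = -1 by ring]
    | succ n ih =>
      rw [show -q + (q - 1 - ((n + 1 : ℕ) : ℤ)) = -((n : ℤ) + 2) by push_cast; ring,
        hgen _ (by omega)]
      refine bracketSpan_le fun a ha w hw ↦ ?_
      have hw' := ih (by convert hw using 2; ring)
      refine lie_mem_of_mem_bracketSpan hw' fun z hz y hy ↦ ?_
      rw [leibniz_lie, hbot a ha z hz, zero_lie, zero_add]
      refine lie_mem_bracketSpan hz ?_
      convert hgraded _ _ a ha y hy using 2
      push_cast
      ring
  intro i hi hiq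
  obtain ⟨n, rfl⟩ : ∃ n : ℕ, i = q - 1 - n := ⟨(q - 1 - i).toNat, by omega⟩
  exact le_antisymm (key n) (hle _)
end

section
/- Let F be a field of characteristic p > 3 and let g = ⊕_{t∈ℤ} g_t be a finite-dimensional ℤ-graded Lie algebra over F. Let e, f, h ∈ g_0 satisfy ⁅e, f⁆ = h, ⁅h, e⁆ = 2e, ⁅h, f⁆ = −2f, and h ≠ 0. Let i be a nonzero integer and suppose x ∈ g_{−i} and y ∈ g_i satisfy ⁅x, y⁆ = f, ⁅x, e⁆ = 0, ⁅y, f⁆ = 0, ⁅h, x⁆ = λ·x, and ⁅h, y⁆ = μ·y for some scalars λ, μ ∈ F. Then λ = 0 or λ = 1. -/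
/-- The iterated bracket `⁅z, ⁅z, … ⁅z, v⁆⁆⁆` with `n` factors `z`. -/
def adIter {L : Type*} [LieRing L] (z v : L) : ℕ → L
  | 0 => v
  | n + 1 => ⁅z, adIter z v n⁆

section Iterates

variable {K L : Type*} [Field K] [LieRing L] [LieAlgebra K L]

lemma adIter_mem {g : ℤ → Submodule K L}
    (hg : ∀ i j : ℤ, ∀ x ∈ g i, ∀ y ∈ g j, ⁅x, y⁆ ∈ g (i + j))
    {d j : ℤ} {z v : L} (hz : z ∈ g d) (hv : v ∈ g j) (n : ℕ) :
    adIter z v n ∈ g (n * d + j) := by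
  induction n with
  | zero => simpa [adIter] using hv
  | succ n ih =>
    have := hg _ _ _ hz _ ih
    rwa [show d + (n * d + j) = (n + 1 : ℕ) * d + j by push_cast; ring] at this

/-- In a finite-dimensional graded Lie algebra, homogeneous elements of nonzero degree act
nilpotently on homogeneous elements. -/
lemma exists_adIter_eq_zero [FiniteDimensional K L] {g : ℤ → Submodule K L}
    (hdirect : DirectSum.IsInternal g)
    (hg : ∀ i j : ℤ, ∀ x ∈ g i, ∀ y ∈ g j, ⁅x, y⁆ ∈ g (i + j))
    {d j : ℤ} (hd : d ≠ 0) {z v : L} (hz : z ∈ g d) (hv : v ∈ g j) :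
    ∃ n, adIter z v n = 0 := by
  by_contra! hne
  have hfin : {i | g i ≠ ⊥}.Finite :=
    WellFoundedGT.finite_ne_bot_of_iSupIndep hdirect.submodule_iSupIndep
  have hinj : Function.Injective (fun n : ℕ ↦ (n * d + j : ℤ)) := by
    intro a b hab
    have : (a : ℤ) * d = b * d := by simpa using hab
    exact_mod_cast mul_right_cancel₀ hd this
  refine Set.infinite_range_of_injective hinj (hfin.subset ?_)
  rintro _ ⟨n, rfl⟩ hbot
  have := adIter_mem hg hz hv n
  simp only at hbot
  rw [hbot, Submodule.mem_bot] at this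
  exact hne n this

/-- The affine configuration of type `A₁⁽¹⁾` with a common coroot: the product of the two raising
elements acts without nilpotency. -/
lemma adIter_ne_zero_of_affine {e f h e' f' : L}
    (h2 : (2 : K) ≠ 0) (he0 : e ≠ 0) (hef : ⁅e, f⁆ = h) (hhe : ⁅h, e⁆ = (2 : K) • e)
    (hef' : ⁅e', f'⁆ = h) (h12 : ⁅e, f'⁆ = 0) (h21 : ⁅e', f⁆ = 0)
    (hhf' : ⁅h, f'⁆ = (2 : K) • f') (n : ℕ) :
    adIter ⁅e, e'⁆ e n ≠ 0 := by
  have h12' : ⁅f', e⁆ = 0 := by rw [← lie_skew, h12, neg_zero]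
  have h21' : ⁅f, e'⁆ = 0 := by rw [← lie_skew, h21, neg_zero]
  have hfe : ⁅f, e⁆ = -h := by rw [← lie_skew, hef]
  have hfe' : ⁅f', e'⁆ = -h := by rw [← lie_skew, hef']
  have heh : ⁅e, h⁆ = (-2 : K) • e := by rw [← lie_skew, hhe]; module
  have hfh' : ⁅f', h⁆ = (-2 : K) • f' := by rw [← lie_skew, hhf']; module
  have hwf : ⁅⁅e, e'⁆, f'⁆ = (-2 : K) • e := by
    rw [lie_lie, hef', h12, lie_zero, heh, sub_zero]
  have hWe : ⁅⁅f', f⁆, e⁆ = (2 : K) • f' := by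
    rw [lie_lie, hfe, h12', lie_zero, lie_neg, hfh']; module
  have hWe' : ⁅⁅f', f⁆, e'⁆ = ⁅f, h⁆ := by
    rw [lie_lie, h21', hfe', lie_zero, lie_neg, zero_sub, neg_neg]
  have hWw : ⁅⁅f', f⁆, ⁅e, e'⁆⁆ = 0 := by
    have h1 : ⁅e, ⁅f, h⁆⁆ = (2 : K) • h := by
      rw [leibniz_lie, hef, lie_self, heh, lie_smul, hfe]; module
    rw [leibniz_lie, hWe, hWe', smul_lie, hfe', h1]; module
  have hstep : ∀ m, ⁅⁅f', f⁆, adIter ⁅e, e'⁆ e (m + 1)⁆ = (-4 : K) • adIter ⁅e, e'⁆ e m := by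
    intro m
    induction m with
    | zero =>
      simp only [adIter]
      rw [leibniz_lie, hWw, zero_lie, hWe, lie_smul, hwf]; module
    | succ m ih =>
      rw [adIter, leibniz_lie, hWw, zero_lie, ih, lie_smul, adIter]; module
  have h4 : (-4 : K) ≠ 0 := by
    rw [show (-4 : K) = -(2 * 2) by norm_num]
    exact neg_ne_zero.2 (mul_ne_zero h2 h2)
  induction n with
  | zero => simpa [adIter] using he0
  | succ n ih =>
    intro h0
    have := hstep n
    rw [h0, lie_zero, eq_comm, smul_eq_zero] at this
    exact this.elim h4 ih

end Iterates

section RankOne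

variable {K L : Type*} [Field K] [LieRing L] [LieAlgebra K L]

/-- Two commuting raising/lowering pairs `(e, f)` and `(e', f')` with a common coroot `h`, where
`h` acts on `e` by `2` and on `e'` by `t`. -/
structure RankOnePair (t : K) (e f h e' f' : L) : Prop where
  ef : ⁅e, f⁆ = h
  he : ⁅h, e⁆ = (2 : K) • e
  hf : ⁅h, f⁆ = (-2 : K) • f
  ef' : ⁅e', f'⁆ = h
  he' : ⁅h, e'⁆ = t • e'
  hf' : ⁅h, f'⁆ = (-t) • f'
  e_f' : ⁅e, f'⁆ = 0
  e'_f : ⁅e', f⁆ = 0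

namespace RankOnePair

variable {t : K} {e f h e' f' : L}

/-- The Chevalley involution. -/
lemma opp (H : RankOnePair t e f h e' f') : RankOnePair t f e (-h) f' e' where
  ef := by rw [← lie_skew, H.ef]
  he := by rw [neg_lie, H.hf]; module
  hf := by rw [neg_lie, H.he]; module
  ef' := by rw [← lie_skew, H.ef']
  he' := by rw [neg_lie, H.hf']; module
  hf' := by rw [neg_lie, H.he']; module
  e_f' := by rw [← lie_skew, H.e'_f, neg_zero]
  e'_f := by rw [← lie_skew, H.e_f', neg_zero]

/-- Exchanging the two pairs, after rescaling so that the coroot acts on `e'` by `2`. -/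
lemma swap (H : RankOnePair t e f h e' f') (ht : t ≠ 0) :
    RankOnePair (4 / t) ((2 / t) • e') f' ((2 / t) • h) e ((2 / t) • f) where
  ef := by rw [smul_lie, H.ef']
  he := by
    rw [smul_lie, lie_smul, H.he']; match_scalars; field_simp
  hf := by rw [smul_lie, H.hf']; match_scalars; field_simp
  ef' := by rw [lie_smul, H.ef]
  he' := by rw [smul_lie, H.he]; match_scalars; field_simp; norm_num
  hf' := by rw [smul_lie, lie_smul, H.hf]; match_scalars; field_simp; norm_num
  e_f' := by rw [smul_lie, lie_smul, H.e'_f, smul_zero, smul_zero]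
  e'_f := H.e_f'

lemma lie_h_adIter (H : RankOnePair t e f h e' f') (k : ℕ) :
    ⁅h, adIter e' e k⁆ = (2 + k * t) • adIter e' e k := by
  induction k with
  | zero => simpa [adIter] using H.he
  | succ k ih =>
    rw [adIter, leibniz_lie, H.he', ih, lie_smul, smul_lie]; push_cast; module

lemma lie_adIter_f' (H : RankOnePair t e f h e' f') (h2 : (2 : K) ≠ 0) (k : ℕ) :
    ⁅adIter e' e (k + 1), f'⁆ = ((k + 1) * (4 + t * k) / 2) • adIter e' e k := by
  have hAh : ∀ k, ⁅adIter e' e k, h⁆ = (-(2 + k * t)) • adIter e' e k := fun k ↦ by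
    rw [← lie_skew, H.lie_h_adIter]; module
  induction k with
  | zero =>
    simp only [adIter]
    rw [lie_lie, H.e_f', H.ef', lie_zero, ← lie_skew, H.he]
    match_scalars; field_simp; norm_num
  | succ k ih =>
    rw [adIter, lie_lie, ih, H.ef', hAh, lie_smul, ← adIter]
    match_scalars; field_simp; ring

lemma lie_f_adIter (H : RankOnePair t e f h e' f') (k : ℕ) :
    ⁅f, adIter e' e (k + 2)⁆ = 0 := by
  have hfe : ⁅f, e'⁆ = 0 := by rw [← lie_skew, H.e'_f, neg_zero]
  have hfe' : ⁅f, e⁆ = -h := by rw [← lie_skew, H.ef]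
  have heh : ⁅e', h⁆ = (-t) • e' := by rw [← lie_skew, H.he']; module
  induction k with
  | zero =>
    simp only [adIter]
    rw [leibniz_lie, hfe, zero_lie, leibniz_lie f, hfe, zero_lie, hfe', lie_neg, heh]
    simp
  | succ k ih =>
    rw [adIter, leibniz_lie, hfe, ih]; simp

lemma lie_adIter_adIter (H : RankOnePair t e f h e' f') (h2 : (2 : K) ≠ 0) (k : ℕ) :
    ⁅adIter e' e k, adIter f' f k⁆ =
      ((k * t + 2) / 2 * ∏ j ∈ Finset.range k, ((j + 1) * (4 + t * j) / 2)) • h ∧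
    ⁅adIter e' e (k + 1), adIter f' f k⁆ =
      (-(t / 2) * ∏ j ∈ Finset.range (k + 1), ((j + 1) * (4 + t * j) / 2)) • e' := by
  have heh : ⁅e', h⁆ = (-t) • e' := by rw [← lie_skew, H.he']; module
  have hfe : ⁅f', e'⁆ = -h := by rw [← lie_skew, H.ef']
  induction k with
  | zero =>
    constructor
    · simp only [adIter, H.ef]; simp [h2]
    · simp only [adIter]
      rw [lie_lie, H.ef, H.e'_f, heh]
      simp
      match_scalars; field_simp; norm_num
  | succ k ih =>
    obtain ⟨ih1, ih2⟩ := ih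
    have key : ⁅adIter e' e (k + 1), adIter f' f (k + 1)⁆ =
      (((k + 1 : ℕ) * t + 2) / 2 *
        ∏ j ∈ Finset.range (k + 1), ((j + 1) * (4 + t * j) / 2)) • h := by
      rw [show adIter f' f (k + 1) = ⁅f', adIter f' f k⁆ from rfl, leibniz_lie,
        H.lie_adIter_f' h2, ih2, smul_lie, lie_smul, ih1, hfe, Finset.prod_range_succ]
      match_scalars; field_simp; ring
    refine ⟨key, ?_⟩
    have hEB : ⁅e', adIter f' f (k + 1)⁆ = (-((k + 1) * (4 + t * k) / 2)) • adIter f' f k := by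
      rw [← lie_skew, H.opp.lie_adIter_f' h2]; module
    rw [show adIter e' e (k + 1 + 1) = ⁅e', adIter e' e (k + 1)⁆ from rfl, lie_lie, key, hEB,
      lie_smul, lie_smul, ih2, heh, Finset.prod_range_succ _ (k + 1), Finset.prod_range_succ]
    match_scalars; field_simp; ring

variable [FiniteDimensional K L] {g : ℤ → Submodule K L} (p : ℕ) [CharP K p]

lemma false_of_two_le (H : RankOnePair t e f h e' f') (hp : 3 < p) (hh0 : h ≠ 0)
    (hdirect : DirectSum.IsInternal g)
    (hg : ∀ i j : ℤ, ∀ x ∈ g i, ∀ y ∈ g j, ⁅x, y⁆ ∈ g (i + j))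
    {r s : ℤ} (her : e ∈ g r) (hes : e' ∈ g s) {a : ℕ} (ha2 : 2 ≤ a) (hap : a < p)
    (hat : a * t = -4) (hdeg : 2 * r + a * s ≠ 0) : False := by
  have hcast : ∀ m : ℕ, 0 < m → m < p → (m : K) ≠ 0 := fun m h0 h1 hm ↦
    Nat.not_dvd_of_pos_of_lt h0 h1 ((CharP.cast_eq_zero_iff K p m).1 hm)
  have h2 : (2 : K) ≠ 0 := by exact_mod_cast hcast 2 (by omega) (by omega)
  have ht : t ≠ 0 := by
    rintro rfl
    apply mul_ne_zero h2 h2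
    linear_combination hat
  set P : K := ∏ j ∈ Finset.range a, ((j + 1) * (4 + t * j) / 2) with hP
  have hP0 : P ≠ 0 := by
    refine Finset.prod_ne_zero_iff.2 fun j hj ↦ ?_
    have hja : j < a := Finset.mem_range.1 hj
    refine div_ne_zero (mul_ne_zero ?_ ?_) h2
    · exact_mod_cast hcast (j + 1) (by omega) (by omega)
    · have : (4 + t * j : K) = -(t * ((a - j : ℕ) : K)) := by
        rw [Nat.cast_sub hja.le]; linear_combination hat
      rw [this]
      exact neg_ne_zero.2 (mul_ne_zero ht (hcast _ (by omega) (by omega)))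
  obtain ⟨b, rfl⟩ : ∃ b, a = b + 2 := ⟨a - 2, by omega⟩
  have hAB : ⁅adIter e' e (b + 2), adIter f' f (b + 2)⁆ = (-P) • h := by
    rw [(H.lie_adIter_adIter h2 (b + 2)).1, ← hP, hat]
    match_scalars; field_simp; norm_num
  have hhB := H.opp.lie_h_adIter (b + 2)
  have he0 : e ≠ 0 := by
    rintro rfl
    exact hh0 (by rw [← H.ef, zero_lie])
  have hw : ⁅e, (-P)⁻¹ • adIter e' e (b + 2)⁆ ∈ g (r + ((b + 2 : ℕ) * s + r)) :=
    hg _ _ _ her _ ((g _).smul_mem _ (adIter_mem hg hes her _))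
  obtain ⟨n, hn⟩ := exists_adIter_eq_zero hdirect hg
    (fun h0 ↦ hdeg (by rw [← h0]; ring)) hw her
  refine adIter_ne_zero_of_affine (K := K) (f' := adIter f' f (b + 2)) h2 he0
    H.ef H.he ?_ ?_ ?_ ?_ n hn
  · rw [smul_lie, hAB, smul_smul, inv_mul_cancel₀ (neg_ne_zero.2 hP0), one_smul]
  · exact H.opp.lie_f_adIter b
  · rw [smul_lie, ← lie_skew, H.lie_f_adIter b]; simp
  · rw [neg_lie, hat] at hhB
    rw [← neg_neg ⁅h, _⁆, hhB]; module

/-- A nontrivial rank one pair cannot occur in a finite-dimensional graded Lie algebra with `e`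
of degree `0` and `e'` of nonzero degree. -/
lemma false_of_degree (H : RankOnePair t e f h e' f') (hp : 3 < p) (hh0 : h ≠ 0)
    (hdirect : DirectSum.IsInternal g)
    (hg : ∀ i j : ℤ, ∀ x ∈ g i, ∀ y ∈ g j, ⁅x, y⁆ ∈ g (i + j))
    {s : ℤ} (hs : s ≠ 0) (her : e ∈ g 0) (hes : e' ∈ g s) {a : ℕ} (ha : a ≠ 0) (hap : a < p)
    (hat : a * t = -4) : False := by
  rcases (show 2 ≤ a ∨ a = 1 by omega) with ha2 | rfl
  · exact H.false_of_two_le p hp hh0 hdirect hg her hes ha2 hap hat (by simp [hs, ha])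
  · have h2 : (2 : K) ≠ 0 := by
      intro h
      have := (CharP.cast_eq_zero_iff K p 2).1 (by exact_mod_cast h)
      have := Nat.le_of_dvd (by norm_num) this
      omega
    have h4 : (-4 : K) ≠ 0 := by
      rw [show (-4 : K) = -(2 * 2) by norm_num]
      exact neg_ne_zero.2 (mul_ne_zero h2 h2)
    have hp4 : p ≠ 4 := by
      rintro rfl
      rcases CharP.char_is_prime_or_zero K 4 with h | h
      · exact absurd h (by norm_num)
      · omega
    obtain rfl : t = -4 := by simpa using hat
    refine (H.swap h4).false_of_two_le p hp (smul_ne_zero (div_ne_zero h2 h4) hh0) hdirect hg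
      ((g s).smul_mem _ hes) her (a := 4) (by norm_num) (by omega) ?_ (by simpa using hs)
    push_cast
    field_simp

end RankOnePair

end RankOne

section CharP

variable {K : Type*} [Field K] (p : ℕ) [CharP K p]

lemma exists_natCast_mul_eq_intCast (hp : p ≠ 0) {u v : ℤ} (hu : (u : K) ≠ 0) (hv : (v : K) ≠ 0) :
    ∃ a : ℕ, a ≠ 0 ∧ a < p ∧ (a : K) * v = u := by
  have : Fact p.Prime := ⟨(CharP.char_is_prime_or_zero K p).resolve_right hp⟩
  let φ : ZMod p →+* K := ZMod.castHom dvd_rfl K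
  set α : ZMod p := u / v
  have hv' : (v : ZMod p) ≠ 0 := fun h ↦ hv (by simpa only [map_intCast, map_zero] using congrArg φ h)
  have ha : (α.val : K) * v = u := by
    have h1 : ((α.val : ℕ) : ZMod p) * v = u := by
      rw [ZMod.natCast_zmod_val]; exact div_mul_cancel₀ _ hv'
    simpa only [map_mul, map_natCast, map_intCast] using congrArg φ h1
  refine ⟨α.val, ?_, ZMod.val_lt α, ha⟩
  intro h0
  rw [h0, Nat.cast_zero, zero_mul] at ha
  exact hu ha.symm

lemma natCast_sq_add_two_ne_zero (hp : 3 < p) (k : ℕ) {lam : K}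
    (hk : lam * (k ^ 2 + k + 2) = 4 * k) : (k ^ 2 + k + 2 : K) ≠ 0 := by
  intro h0
  have h2 : (2 : K) ≠ 0 := by
    intro h
    have := Nat.le_of_dvd (by norm_num) ((CharP.cast_eq_zero_iff K p 2).1 (by exact_mod_cast h))
    omega
  rw [h0, mul_zero, eq_comm, show (4 : K) = 2 * 2 by norm_num] at hk
  have hk0 : (k : K) = 0 := by simpa [h2] using hk
  rw [hk0] at h0
  exact h2 (by linear_combination h0)

end CharP

section Configuration

variable {K L : Type*} [Field K] [LieRing L] [LieAlgebra K L]

/-- An `sl₂`-triple `(e, f, h)`, a highest weight vector `x` of weight `lam` and a lowest weight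
vector `y` with `⁅x, y⁆ = f`. -/
structure LoweringPair (lam : K) (e f h x y : L) : Prop where
  ef : ⁅e, f⁆ = h
  he : ⁅h, e⁆ = (2 : K) • e
  hf : ⁅h, f⁆ = (-2 : K) • f
  xy : ⁅x, y⁆ = f
  xe : ⁅x, e⁆ = 0
  yf : ⁅y, f⁆ = 0
  hx : ⁅h, x⁆ = lam • x
  hy : ⁅h, y⁆ = (-2 - lam) • y

namespace LoweringPair

variable {lam : K} {e f h x y : L}

lemma ex (H : LoweringPair lam e f h x y) : ⁅e, x⁆ = 0 := by rw [← lie_skew, H.xe, neg_zero]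

lemma fe (H : LoweringPair lam e f h x y) : ⁅f, e⁆ = -h := by rw [← lie_skew, H.ef]

lemma fy (H : LoweringPair lam e f h x y) : ⁅f, y⁆ = 0 := by rw [← lie_skew, H.yf, neg_zero]

lemma eh (H : LoweringPair lam e f h x y) : ⁅e, h⁆ = (-2 : K) • e := by
  rw [← lie_skew, H.he]; module

lemma fh (H : LoweringPair lam e f h x y) : ⁅f, h⁆ = (2 : K) • f := by
  rw [← lie_skew, H.hf]; module

lemma xh (H : LoweringPair lam e f h x y) : ⁅x, h⁆ = (-lam) • x := by
  rw [← lie_skew, H.hx]; module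

lemma e_fx (H : LoweringPair lam e f h x y) : ⁅e, ⁅f, x⁆⁆ = lam • x := by
  rw [leibniz_lie, H.ef, H.ex, H.hx]; simp

lemma fx_e (H : LoweringPair lam e f h x y) : ⁅⁅f, x⁆, e⁆ = (-lam) • x := by
  rw [← lie_skew, H.e_fx]; module

lemma h_fx (H : LoweringPair lam e f h x y) : ⁅h, ⁅f, x⁆⁆ = (lam - 2) • ⁅f, x⁆ := by
  rw [leibniz_lie, H.hf, H.hx, smul_lie, lie_smul]; module

lemma h_ey (H : LoweringPair lam e f h x y) : ⁅h, ⁅e, y⁆⁆ = (-lam) • ⁅e, y⁆ := by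
  rw [leibniz_lie, H.he, H.hy, smul_lie, lie_smul]; module

lemma h_eey (H : LoweringPair lam e f h x y) :
    ⁅h, ⁅e, ⁅e, y⁆⁆⁆ = (2 - lam) • ⁅e, ⁅e, y⁆⁆ := by
  rw [leibniz_lie, H.he, H.h_ey, smul_lie, lie_smul]; module

lemma h_eeey (H : LoweringPair lam e f h x y) :
    ⁅h, ⁅e, ⁅e, ⁅e, y⁆⁆⁆⁆ = (4 - lam) • ⁅e, ⁅e, ⁅e, y⁆⁆⁆ := by
  rw [leibniz_lie, H.he, H.h_eey, smul_lie, lie_smul]; module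

lemma f_ey (H : LoweringPair lam e f h x y) : ⁅f, ⁅e, y⁆⁆ = (2 + lam) • y := by
  rw [leibniz_lie, H.fe, H.fy, neg_lie, H.hy, lie_zero]; module

lemma f_eey (H : LoweringPair lam e f h x y) :
    ⁅f, ⁅e, ⁅e, y⁆⁆⁆ = (2 * (1 + lam)) • ⁅e, y⁆ := by
  rw [leibniz_lie, H.fe, H.f_ey, neg_lie, H.h_ey, lie_smul]; module

lemma f_eeey (H : LoweringPair lam e f h x y) :
    ⁅f, ⁅e, ⁅e, ⁅e, y⁆⁆⁆⁆ = (3 * lam) • ⁅e, ⁅e, y⁆⁆ := by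
  rw [leibniz_lie, H.fe, H.f_eey, neg_lie, H.h_eey, lie_smul]; module

lemma x_ey (H : LoweringPair lam e f h x y) : ⁅x, ⁅e, y⁆⁆ = h := by
  rw [leibniz_lie, H.xe, H.xy, H.ef]; simp

lemma x_eey (H : LoweringPair lam e f h x y) : ⁅x, ⁅e, ⁅e, y⁆⁆⁆ = (-2 : K) • e := by
  rw [leibniz_lie, H.xe, H.x_ey, H.eh]; simp

lemma x_eeey (H : LoweringPair lam e f h x y) : ⁅x, ⁅e, ⁅e, ⁅e, y⁆⁆⁆⁆ = 0 := by
  rw [leibniz_lie, H.xe, H.x_eey]; simp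

lemma fx_y (H : LoweringPair lam e f h x y) : ⁅⁅f, x⁆, y⁆ = 0 := by
  rw [lie_lie, H.xy, H.fy]; simp

lemma fx_ey (H : LoweringPair lam e f h x y) : ⁅⁅f, x⁆, ⁅e, y⁆⁆ = (-lam) • f := by
  rw [lie_lie, H.x_ey, H.f_ey, H.fh, lie_smul, H.xy]; module

lemma fx_eey (H : LoweringPair lam e f h x y) :
    ⁅⁅f, x⁆, ⁅e, ⁅e, y⁆⁆⁆ = (-2 * lam) • h := by
  rw [lie_lie, H.x_eey, H.f_eey, lie_smul, lie_smul, H.fe, H.x_ey]; module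

lemma fx_eeey (H : LoweringPair lam e f h x y) :
    ⁅⁅f, x⁆, ⁅e, ⁅e, ⁅e, y⁆⁆⁆⁆ = (6 * lam) • e := by
  rw [lie_lie, H.x_eeey, H.f_eeey, lie_zero, lie_smul, H.x_eey]; module

lemma lie_h_adIter (H : LoweringPair lam e f h x y) (k : ℕ) :
    ⁅h, adIter x ⁅f, x⁆ k⁆ = ((k + 1) * lam - 2) • adIter x ⁅f, x⁆ k := by
  induction k with
  | zero => simp only [adIter, H.h_fx]; simp
  | succ k ih =>
    rw [adIter, leibniz_lie, H.hx, ih, smul_lie, lie_smul]; push_cast; module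

lemma lie_ey_adIter (H : LoweringPair lam e f h x y) (h2 : (2 : K) ≠ 0) (k : ℕ) :
    ⁅⁅e, y⁆, adIter x ⁅f, x⁆ (k + 1)⁆ =
      (2 * (k + 1) - lam * ((k + 1) ^ 2 + (k + 1) + 2) / 2) • adIter x ⁅f, x⁆ k := by
  have hyx : ⁅⁅e, y⁆, x⁆ = -h := by rw [← lie_skew, H.x_ey]
  induction k with
  | zero =>
    have h1 : ⁅⁅e, y⁆, ⁅f, x⁆⁆ = lam • f := by rw [← lie_skew, H.fx_ey]; module
    have hxf : ⁅x, f⁆ = -⁅f, x⁆ := by rw [lie_skew]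
    simp only [adIter]
    rw [leibniz_lie, hyx, neg_lie, H.h_fx, h1, lie_smul, hxf]
    match_scalars; field_simp; ring
  | succ k ih =>
    rw [adIter, leibniz_lie, hyx, neg_lie, H.lie_h_adIter, ih, lie_smul, ← adIter]
    match_scalars; field_simp; ring

lemma e_xfx (H : LoweringPair lam e f h x y) : ⁅e, ⁅x, ⁅f, x⁆⁆⁆ = 0 := by
  rw [leibniz_lie, H.ex, H.e_fx]; simp

lemma h_xfx (H : LoweringPair lam e f h x y) :
    ⁅h, ⁅x, ⁅f, x⁆⁆⁆ = (-(2 - 2 * lam)) • ⁅x, ⁅f, x⁆⁆ := by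
  rw [leibniz_lie, H.hx, H.h_fx, smul_lie, lie_smul]; module

/-- The lowest weight vector of weight `2 - 2 * lam` in the second exterior power of the
`sl₂`-module generated by `y`. -/
def quad (lam : K) (e y : L) : L :=
  (-(2 + lam)) • ⁅y, ⁅e, ⁅e, ⁅e, y⁆⁆⁆⁆ + (3 * lam) • ⁅⁅e, y⁆, ⁅e, ⁅e, y⁆⁆⁆

lemma f_quad (H : LoweringPair lam e f h x y) : ⁅f, quad lam e y⁆ = 0 := by
  rw [quad, lie_add, lie_smul, lie_smul, leibniz_lie f y, leibniz_lie f ⁅e, y⁆, H.fy, H.f_eeey, H.f_ey,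
    H.f_eey, lie_smul, lie_smul, smul_lie, lie_self, zero_lie]
  module

lemma h_quad (H : LoweringPair lam e f h x y) :
    ⁅h, quad lam e y⁆ = (2 - 2 * lam) • quad lam e y := by
  rw [quad, lie_add, lie_smul, lie_smul, leibniz_lie h y, leibniz_lie h ⁅e, y⁆, H.hy, H.h_eeey, H.h_ey,
    H.h_eey, lie_smul, lie_smul, smul_lie, smul_lie]
  module

lemma x_quad (H : LoweringPair lam e f h x y) :
    ⁅x, quad lam e y⁆ = (6 * lam * (1 - lam)) • ⁅e, ⁅e, y⁆⁆ := by
  rw [quad, lie_add, lie_smul, lie_smul, leibniz_lie x y, leibniz_lie x ⁅e, y⁆, H.xy, H.x_eeey, H.x_ey,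
    H.x_eey, H.f_eeey, H.h_eey, lie_smul, ← lie_skew ⁅e, y⁆ e, lie_zero]
  module

lemma fx_quad (H : LoweringPair lam e f h x y) :
    ⁅⁅f, x⁆, quad lam e y⁆ = (12 * lam * (1 - lam) * (1 + lam)) • ⁅e, y⁆ := by
  rw [lie_lie, H.x_quad, H.f_quad, lie_smul, H.f_eey, lie_zero]
  module

lemma xfx_quad (H : LoweringPair lam e f h x y) :
    ⁅⁅x, ⁅f, x⁆⁆, quad lam e y⁆ = (12 * lam * (1 - lam) * (1 + 2 * lam)) • h := by
  rw [lie_lie, H.x_quad, H.fx_quad, lie_smul, lie_smul, H.x_ey, H.fx_eey]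
  module

lemma rankOnePair_quad (H : LoweringPair lam e f h x y)
    (hc : 12 * lam * (1 - lam) * (1 + 2 * lam) ≠ 0) :
    RankOnePair (2 - 2 * lam) e f h
      ((-(12 * lam * (1 - lam) * (1 + 2 * lam)))⁻¹ • quad lam e y) ⁅x, ⁅f, x⁆⁆ where
  ef := H.ef
  he := H.he
  hf := H.hf
  ef' := by
    rw [smul_lie, ← lie_skew, H.xfx_quad, ← neg_smul, smul_smul, inv_mul_cancel₀ (neg_ne_zero.2 hc),
      one_smul]
  he' := by rw [lie_smul, H.h_quad, smul_comm]
  hf' := H.h_xfx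
  e_f' := H.e_xfx
  e'_f := by rw [smul_lie, ← lie_skew, H.f_quad]; simp

/-- A lowest weight vector of degree three, for `lam = -1 / 2`. -/
def cubic (lam : K) (e y : L) : L :=
  ⁅y, ⁅e, quad lam e y⁆⁆ + (2 : K) • ⁅⁅e, y⁆, quad lam e y⁆

lemma f_cubic (h2 : (2 : K) ≠ 0) (H : LoweringPair (-1 / 2 : K) e f h x y) :
    ⁅f, cubic (-1 / 2 : K) e y⁆ = 0 := by
  rw [cubic, lie_add, lie_smul, leibniz_lie f y, leibniz_lie f ⁅e, y⁆, leibniz_lie f e, H.fy, H.fe, H.f_ey,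
    H.f_quad, neg_lie, H.h_quad]
  simp only [zero_lie, lie_zero, smul_lie, lie_add, lie_neg, lie_smul]
  match_scalars; field_simp; norm_num

lemma h_cubic (h2 : (2 : K) ≠ 0) (H : LoweringPair (-1 / 2 : K) e f h x y) :
    ⁅h, cubic (-1 / 2 : K) e y⁆ = (7 / 2 : K) • cubic (-1 / 2 : K) e y := by
  rw [cubic, lie_add, lie_smul, leibniz_lie h y, leibniz_lie h ⁅e, y⁆, leibniz_lie h e, H.hy, H.he, H.h_ey,
    H.h_quad]
  simp only [smul_lie, lie_add, lie_smul]
  match_scalars <;> field_simp <;> norm_num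

lemma xxfx_cubic (h2 : (2 : K) ≠ 0) (H : LoweringPair (-1 / 2 : K) e f h x y) :
    ⁅⁅x, ⁅x, ⁅f, x⁆⁆⁆, cubic (-1 / 2 : K) e y⁆ = (-27 / 2 : K) • h := by
  have h4 : (4 : K) ≠ 0 := by
    rw [show (4 : K) = 2 * 2 by norm_num]; exact mul_ne_zero h2 h2
  set z := quad (-1 / 2 : K) e y with hz
  set u := ⁅x, ⁅f, x⁆⁆ with hu
  have xz : ⁅x, z⁆ = (-9 / 2 : K) • ⁅e, ⁅e, y⁆⁆ := by
    rw [hz, H.x_quad]; match_scalars; field_simp; norm_num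
  have fxz : ⁅⁅f, x⁆, z⁆ = (-9 / 2 : K) • ⁅e, y⁆ := by
    rw [hz, H.fx_quad]; match_scalars; field_simp; norm_num
  have uz : ⁅u, z⁆ = 0 := by
    rw [hz, hu, H.xfx_quad]; match_scalars; field_simp; norm_num
  have hz3 : ⁅h, z⁆ = (3 : K) • z := by
    rw [hz, H.h_quad]; match_scalars; field_simp; norm_num
  have ue : ⁅u, e⁆ = 0 := by rw [← lie_skew, hu, H.e_xfx, neg_zero]
  have uez : ⁅u, ⁅e, z⁆⁆ = 0 := by rw [leibniz_lie, ue, uz]; simp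
  have fez : ⁅f, ⁅e, z⁆⁆ = (-3 : K) • z := by
    rw [leibniz_lie, H.fe, neg_lie, hz3, hz, H.f_quad, lie_zero]; module
  have xez : ⁅x, ⁅e, z⁆⁆ = (-9 / 2 : K) • ⁅e, ⁅e, ⁅e, y⁆⁆⁆ := by
    rw [leibniz_lie, H.xe, xz, zero_lie, lie_smul, zero_add]
  have uy : ⁅u, y⁆ = ⁅f, ⁅f, x⁆⁆ := by
    rw [hu, lie_lie, H.fx_y, H.xy, lie_zero, zero_sub, lie_skew]
  have uey : ⁅u, ⁅e, y⁆⁆ = (-3 : K) • ⁅f, x⁆ := by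
    rw [hu, lie_lie, H.x_ey, H.fx_ey, lie_smul, ← lie_skew, ← lie_skew ⁅f, x⁆ h, H.h_fx]
    match_scalars; field_simp; norm_num
  have ueey : ⁅u, ⁅e, ⁅e, y⁆⁆⁆ = (3 / 2 : K) • x := by
    rw [hu, lie_lie, H.x_eey, H.fx_eey, lie_smul, lie_smul, H.xh, H.fx_e]
    match_scalars; field_simp; norm_num
  have ueeey : ⁅u, ⁅e, ⁅e, ⁅e, y⁆⁆⁆⁆ = 0 := by
    rw [hu, lie_lie, H.x_eeey, H.fx_eeey, lie_smul, H.xe]; simp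
  have effx : ⁅e, ⁅f, ⁅f, x⁆⁆⁆ = (-3 : K) • ⁅f, x⁆ := by
    rw [leibniz_lie, H.ef, H.h_fx, H.e_fx, lie_smul]
    match_scalars; field_simp; norm_num
  have ffxz : ⁅⁅f, ⁅f, x⁆⁆, z⁆ = (-27 / 4 : K) • y := by
    rw [lie_lie, fxz, hz, H.f_quad, lie_smul, H.f_ey, lie_zero]
    match_scalars; field_simp; norm_num
  have ffxez : ⁅⁅f, ⁅f, x⁆⁆, ⁅e, z⁆⁆ = (-81 / 4 : K) • ⁅e, y⁆ := by
    rw [leibniz_lie, ← lie_skew _ e, effx, ffxz, neg_lie, smul_lie, fxz, lie_smul]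
    match_scalars; field_simp; norm_num
  have ffxeeey : ⁅⁅f, ⁅f, x⁆⁆, ⁅e, ⁅e, ⁅e, y⁆⁆⁆⁆ = (9 / 2 : K) • h := by
    rw [lie_lie, H.fx_eeey, H.f_eeey, lie_smul, lie_smul, H.fe, H.fx_eey]
    match_scalars; field_simp; norm_num
  have eyx : ⁅⁅e, y⁆, x⁆ = -h := by rw [← lie_skew, H.x_ey]
  have uc : ⁅u, cubic (-1 / 2 : K) e y⁆ = (27 / 4 : K) • ⁅e, y⁆ := by
    rw [cubic, ← hz, lie_add, lie_smul, leibniz_lie u y, leibniz_lie u ⁅e, y⁆, uy, uez, uey, uz, smul_lie,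
      ffxez, fxz, lie_zero, lie_zero]
    match_scalars; field_simp; norm_num
  have xc : ⁅x, cubic (-1 / 2 : K) e y⁆ = (-9 : K) • ⁅y, ⁅e, ⁅e, ⁅e, y⁆⁆⁆⁆ +
      (-27 / 2 : K) • ⁅⁅e, y⁆, ⁅e, ⁅e, y⁆⁆⁆ := by
    rw [cubic, ← hz, lie_add, lie_smul, leibniz_lie x y, leibniz_lie x ⁅e, y⁆, H.xy, fez, xez, H.x_ey, hz3,
      xz, lie_smul, lie_smul, hz, quad]
    match_scalars <;> field_simp <;> norm_num
  rw [lie_lie, uc, xc, lie_smul, H.x_ey, lie_add, lie_smul, lie_smul, leibniz_lie u y,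
    leibniz_lie u ⁅e, y⁆, uy, ueeey, ffxeeey, uey, ueey, smul_lie, H.fx_eey, lie_smul, eyx, lie_zero]
  match_scalars; field_simp; norm_num

lemma rankOnePair_cubic (h2 : (2 : K) ≠ 0) (h3 : (3 : K) ≠ 0)
    (H : LoweringPair (-1 / 2 : K) e f h x y) :
    RankOnePair (7 / 2 : K) e f h ((2 / 27 : K) • cubic (-1 / 2 : K) e y)
      ⁅x, ⁅x, ⁅f, x⁆⁆⁆ where
  ef := H.ef
  he := H.he
  hf := H.hf
  ef' := by
    have : (27 : K) ≠ 0 := by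
      rw [show (27 : K) = 3 ^ 3 by norm_num]; exact pow_ne_zero 3 h3
    rw [smul_lie, ← lie_skew, H.xxfx_cubic h2]
    match_scalars; field_simp
  he' := by rw [lie_smul, H.h_cubic h2, smul_comm]
  hf' := by
    rw [leibniz_lie, H.hx, H.h_xfx, smul_lie, lie_smul]
    match_scalars; field_simp; norm_num
  e_f' := by rw [leibniz_lie, H.ex, H.e_xfx]; simp
  e'_f := by rw [smul_lie, ← lie_skew, H.f_cubic h2]; simp

variable [FiniteDimensional K L] {g : ℤ → Submodule K L}

lemma exists_weight_eq (H : LoweringPair lam e f h x y) (h2 : (2 : K) ≠ 0) (hlam : lam ≠ 0)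
    (hx0 : x ≠ 0) (hdirect : DirectSum.IsInternal g)
    (hg : ∀ i j : ℤ, ∀ x ∈ g i, ∀ y ∈ g j, ⁅x, y⁆ ∈ g (i + j))
    {i : ℤ} (hi : i ≠ 0) (hfg : f ∈ g 0) (hxg : x ∈ g i) :
    ∃ k : ℕ, lam * (k ^ 2 + k + 2) = 4 * k := by
  classical
  have hex := exists_adIter_eq_zero hdirect hg hi hxg (hg _ _ _ hfg _ hxg)
  have hspec := Nat.find_spec hex
  obtain hn | ⟨k, hn⟩ : Nat.find hex = 0 ∨ ∃ k, Nat.find hex = k + 1 :=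
    (Nat.eq_zero_or_eq_succ_pred _).imp_right fun h ↦ ⟨_, h⟩
  · rw [hn] at hspec
    have := H.e_fx
    rw [show ⁅f, x⁆ = 0 from hspec, lie_zero, eq_comm, smul_eq_zero] at this
    exact (this.elim hlam hx0).elim
  · have h1 := H.lie_ey_adIter h2 k
    rw [← hn, hspec, lie_zero, eq_comm, smul_eq_zero] at h1
    have h3 := h1.resolve_right (Nat.find_min hex (by omega))
    refine ⟨k + 1, ?_⟩
    field_simp at h3
    push_cast
    linear_combination -h3

end LoweringPair

end Configuration

/-- In a finite-dimensional ℤ-graded Lie algebra over a field of characteristic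
`p > 3`, given an sl₂-triple `e, f, h ∈ g 0` with `h ≠ 0`, and homogeneous elements
`x ∈ g (-i)`, `y ∈ g i` (`i ≠ 0`) with `⁅x,y⁆ = f`, `⁅x,e⁆ = 0`, `⁅y,f⁆ = 0`,
`⁅h,x⁆ = λx`, `⁅h,y⁆ = μy`, one has `λ = 0` or `λ = 1`. -/
theorem statement19 {F L : Type*} [Field F] [LieRing L] [LieAlgebra F L]
    [FiniteDimensional F L]
    (p : ℕ) [CharP F p] (hp : 3 < p)
    (g : ℤ → Submodule F L)
    (hdirect : DirectSum.IsInternal g)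
    (hgraded : ∀ i j : ℤ, ∀ x ∈ g i, ∀ y ∈ g j, ⁅x, y⁆ ∈ g (i + j))
    (e f h : L)
    (he : e ∈ g 0) (hf : f ∈ g 0) (hh : h ∈ g 0)
    (hef : ⁅e, f⁆ = h)
    (hhe : ⁅h, e⁆ = (2 : F) • e) (hhf : ⁅h, f⁆ = (-2 : F) • f)
    (hh0 : h ≠ 0)
    (i : ℤ) (hi : i ≠ 0)
    (x y : L) (hx : x ∈ g (-i)) (hy : y ∈ g i)
    (lam mu : F)
    (hxy : ⁅x, y⁆ = f) (hxe : ⁅x, e⁆ = 0) (hyf : ⁅y, f⁆ = 0)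
    (hhx : ⁅h, x⁆ = lam • x) (hhy : ⁅h, y⁆ = mu • y) :
    lam = 0 ∨ lam = 1 := by
  have hcast : ∀ m : ℕ, (m : F) = 0 ↔ p ∣ m := CharP.cast_eq_zero_iff F p
  have hp4 : p ≠ 4 := by
    rintro rfl
    rcases CharP.char_is_prime_or_zero F 4 with h | h
    · exact absurd h (by norm_num)
    · omega
  have h2 : (2 : F) ≠ 0 := fun h ↦ by
    have := Nat.le_of_dvd (by norm_num) ((hcast 2).1 (by exact_mod_cast h))
    omega
  have h3 : (3 : F) ≠ 0 := fun h ↦ by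
    have := Nat.le_of_dvd (by norm_num) ((hcast 3).1 (by exact_mod_cast h))
    omega
  have h4 : (4 : F) ≠ 0 := by
    rw [show (4 : F) = 2 * 2 by norm_num]; exact mul_ne_zero h2 h2
  have h12 : (12 : F) ≠ 0 := by
    rw [show (12 : F) = 4 * 3 by norm_num]; exact mul_ne_zero h4 h3
  have hf0 : f ≠ 0 := by
    rintro rfl
    exact hh0 (by rw [← hef, lie_zero])
  have hx0 : x ≠ 0 := by
    rintro rfl
    exact hf0 (by rw [← hxy, zero_lie])
  have hmu : mu = -2 - lam := by
    have h1 : ⁅h, f⁆ = (lam + mu) • f := by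
      rw [← hxy, leibniz_lie, hhx, hhy, smul_lie, lie_smul, add_smul]
    rw [hhf] at h1
    linear_combination -smul_left_injective F hf0 h1
  subst hmu
  have H : LoweringPair lam e f h x y := ⟨hef, hhe, hhf, hxy, hxe, hyf, hhx, hhy⟩
  by_contra! hlam
  obtain ⟨hlam0, hlam1⟩ := hlam
  have hlam1' : 1 - lam ≠ 0 := sub_ne_zero.2 hlam1.symm
  obtain ⟨k, hk⟩ := H.exists_weight_eq h2 hlam0 hx0 hdirect hgraded (neg_ne_zero.2 hi) hf hx
  have hey : ⁅e, y⁆ ∈ g i := by simpa using hgraded _ _ _ he _ hy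
  have heey : ⁅e, ⁅e, y⁆⁆ ∈ g i := by simpa using hgraded _ _ _ he _ hey
  have heeey : ⁅e, ⁅e, ⁅e, y⁆⁆⁆ ∈ g i := by simpa using hgraded _ _ _ he _ heey
  have hquad : LoweringPair.quad lam e y ∈ g (i + i) :=
    (g _).add_mem ((g _).smul_mem _ (hgraded _ _ _ hy _ heeey))
      ((g _).smul_mem _ (hgraded _ _ _ hey _ heey))
  by_cases hhalf : 1 + 2 * lam = 0
  · obtain rfl : lam = -1 / 2 := by
      field_simp; linear_combination hhalf
    have h7 : (7 : F) ≠ 0 := by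
      intro h7
      have hp7 : p = 7 := by
        have hdvd := (hcast 7).1 (by exact_mod_cast h7)
        rcases (Nat.dvd_prime (by norm_num)).1 hdvd with h | h <;> omega
      subst hp7
      have h1 : ((k ^ 2 + 9 * k + 2 : ℕ) : F) = 0 := by
        push_cast
        field_simp at hk
        linear_combination -hk
      have h5 := (hcast _).1 h1
      have h6 : ∀ m : ZMod 7, m ^ 2 + 9 * m + 2 ≠ 0 := by decide
      apply h6 k
      exact_mod_cast (ZMod.natCast_eq_zero_iff _ 7).2 h5
    have hcubic : LoweringPair.cubic (-1 / 2 : F) e y ∈ g (i + (i + i)) := by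
      refine (g _).add_mem (hgraded _ _ _ hy _ ?_) ((g _).smul_mem _ (hgraded _ _ _ hey _ hquad))
      simpa using hgraded _ _ _ he _ hquad
    obtain ⟨a, ha0, hap, ha⟩ := exists_natCast_mul_eq_intCast (K := F) p (by omega)
      (u := -8) (v := 7) (by
        push_cast
        rw [show (-8 : F) = -(4 * 2) by norm_num]
        exact neg_ne_zero.2 (mul_ne_zero h4 h2)) (by exact_mod_cast h7)
    refine (H.rankOnePair_cubic h2 h3).false_of_degree p hp hh0 hdirect hgraded
      (by omega) he ((g _).smul_mem _ hcubic) ha0 hap ?_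
    push_cast at ha
    field_simp
    linear_combination ha
  · have hk0 := natCast_sq_add_two_ne_zero p hp k hk
    have ht : (2 - 2 * lam) * (k ^ 2 + k + 2) = 2 * (k ^ 2 - 3 * k + 2) := by
      linear_combination -2 * hk
    have hv : (k ^ 2 - 3 * k + 2 : F) ≠ 0 := by
      intro h0
      rw [h0, mul_zero] at ht
      exact mul_ne_zero (mul_ne_zero h2 hlam1') hk0 (by linear_combination ht)
    obtain ⟨a, ha0, hap, ha⟩ := exists_natCast_mul_eq_intCast (K := F) p (by omega)
      (u := -2 * (k ^ 2 + k + 2)) (v := k ^ 2 - 3 * k + 2)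
      (by push_cast; exact mul_ne_zero (neg_ne_zero.2 h2) hk0) (by push_cast; exact hv)
    refine (H.rankOnePair_quad (mul_ne_zero (mul_ne_zero (mul_ne_zero h12 hlam0) hlam1')
      hhalf)).false_of_degree p hp hh0 hdirect hgraded
      (by omega) he ((g _).smul_mem _ hquad) ha0 hap ?_
    push_cast at ha
    apply mul_right_cancel₀ hk0
    linear_combination 2 * ha + a * ht
end
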